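/- Let P be an ordered logic program. The set of ⊑-minimal proper answer sets of P coincides with the set of proper preferred answer sets of P. -/

import Mathlib

namespace ASP

/-- A literal is an atom `a` or a negated atom `¬ a`. -/
inductive Lit (α : Type) : Type where
  | pos (a : α)
  | neg (a : α)
deriving DecidableEq

/-- Classical negation of a literal. -/
def Lit.negate {α : Type} : Lit α → Lit α
  | .pos a => .neg a
  | .neg a => .pos a

/-- The atom underlying a literal. -/
def Lit.atom {α : Type} : Lit α → α
  | .pos a => a
  | .neg a => a

/-- A rule of a simple logic program: a head which is a literal or absent
(a constraint), and a finite set of literals as body. -/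
structure Rule (α : Type) [DecidableEq α] : Type where
  head : Option (Lit α)
  body : Finset (Lit α)

variable {α : Type} [DecidableEq α]

/-- A set of literals is consistent if it contains no complementary pair. -/
def Consistent (I : Set (Lit α)) : Prop :=
  ∀ a : α, ¬(Lit.pos a ∈ I ∧ Lit.neg a ∈ I)

/-- The Herbrand base of a program: all atoms occurring in it. -/
def herbrand (P : Set (Rule α)) : Set α :=
  {a | ∃ r ∈ P, (∃ l, r.head = some l ∧ l.atom = a) ∨ (∃ l ∈ r.body, l.atom = a)}

/-- An interpretation of `P`: a consistent set of literals over the Herbrand base of `P`. -/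
def IsInterp (P : Set (Rule α)) (I : Set (Lit α)) : Prop :=
  Consistent I ∧ ∀ l ∈ I, l.atom ∈ herbrand P

/-- A rule `a ← β` is satisfied by `I` if `a ∈ I` whenever `β ⊆ I`;
a constraint `← β` is satisfied if its body is not contained in `I`. -/
def Satisfied (I : Set (Lit α)) (r : Rule α) : Prop :=
  ↑r.body ⊆ I → ∃ l, r.head = some l ∧ l ∈ I

/-- A rule is applied w.r.t. `I` if its body holds and its head literal is in `I`. -/
def Applied (I : Set (Lit α)) (r : Rule α) : Prop :=
  ↑r.body ⊆ I ∧ ∃ l, r.head = some l ∧ l ∈ I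

/-- A rule `a ← β` is defeated w.r.t. `P` and `I` iff `P` contains an applied
competing rule `¬a ← β'`. -/
def Defeated (P : Set (Rule α)) (I : Set (Lit α)) (r : Rule α) : Prop :=
  ∃ l, r.head = some l ∧ ∃ r' ∈ P, r'.head = some l.negate ∧ Applied I r'

/-- The reduct of `P` w.r.t. `I`: the rules of `P` satisfied by `I`. -/
def reduct (P : Set (Rule α)) (I : Set (Lit α)) : Set (Rule α) :=
  {r ∈ P | Satisfied I r}

/-- `star R` is the unique minimal model of `R` viewed as a positive program
(negative literals treated as fresh atoms; constraints never fire their head). -/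
def star (R : Set (Rule α)) : Set (Lit α) :=
  ⋂₀ {J : Set (Lit α) | ∀ r ∈ R, ↑r.body ⊆ J → ∀ l, r.head = some l → l ∈ J}

/-- An interpretation is founded iff `(P_I)* = I`. -/
def Founded (P : Set (Rule α)) (I : Set (Lit α)) : Prop :=
  star (reduct P I) = I

/-- A founded interpretation `M` is an extended answer set of `P` iff every rule
of `P` is satisfied or defeated w.r.t. `M`. -/
def ExtAnswerSet (P : Set (Rule α)) (M : Set (Lit α)) : Prop :=
  IsInterp P M ∧ Founded P M ∧ ∀ r ∈ P, Satisfied M r ∨ Defeated P M r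

/-- An answer set of a program without negation as failure: a minimal
interpretation satisfying all rules of the program. -/
def IsAnswerSet (P : Set (Rule α)) (M : Set (Lit α)) : Prop :=
  IsInterp P M ∧ (∀ r ∈ P, Satisfied M r) ∧
    ∀ J, IsInterp P J → (∀ r ∈ P, Satisfied J r) → ¬J ⊂ M


section OLP

variable {α : Type} [DecidableEq α]

/-- `R₁ ⊑ R₂` for sets of rules: every rule in `R₂ \ R₁` is countered by a
`<`-smaller rule in `R₁ \ R₂`. -/
def RuleSq (lt : Rule α → Rule α → Prop) (R₁ R₂ : Set (Rule α)) : Prop :=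
  ∀ r₂ ∈ R₂ \ R₁, ∃ r₁ ∈ R₁ \ R₂, lt r₁ r₂

/-- `M₁ ⊑ M₂` for (extended) answer sets of an ordered program: the induced
order on their reducts. -/
def ASSq (P : Set (Rule α)) (lt : Rule α → Rule α → Prop)
    (M₁ M₂ : Set (Lit α)) : Prop :=
  RuleSq lt (reduct P M₁) (reduct P M₂)

/-- `M₁ ⊏ M₂` iff `M₁ ⊑ M₂` and not `M₂ ⊑ M₁`. -/
def ASLt (P : Set (Rule α)) (lt : Rule α → Rule α → Prop)
    (M₁ M₂ : Set (Lit α)) : Prop :=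
  ASSq P lt M₁ M₂ ∧ ¬ ASSq P lt M₂ M₁

/-- An answer set is proper iff it satisfies all `<`-minimal rules of `P`. -/
def ProperAS (P : Set (Rule α)) (lt : Rule α → Rule α → Prop)
    (M : Set (Lit α)) : Prop :=
  ∀ r ∈ P, (∀ r' ∈ P, ¬ lt r' r) → Satisfied M r

/-- A preferred answer set of the ordered program `(P, lt)`: an extended answer
set of `P` that is `⊑`-minimal among the extended answer sets of `P`. -/
def PreferredAS (P : Set (Rule α)) (lt : Rule α → Rule α → Prop)
    (M : Set (Lit α)) : Prop :=
  ExtAnswerSet P M ∧ ∀ N, ExtAnswerSet P N → ¬ ASLt P lt N M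

end OLP

/-- Properness is inherited downwards along `⊑`: a minimal rule cannot be countered. -/
theorem ProperAS.of_asSq {α : Type} [DecidableEq α] {P : Set (Rule α)}
    {lt : Rule α → Rule α → Prop} {M N : Set (Lit α)}
    (hM : ProperAS P lt M) (hNM : ASSq P lt N M) : ProperAS P lt N := by
  intro r hr hmin
  by_contra hN
  obtain ⟨r', hr', hlt⟩ := hNM r ⟨⟨hr, hM r hr hmin⟩, fun h => hN h.2⟩
  exact hmin r' hr'.1.1 hlt

/-- For an ordered logic program `P = (R, <)`, the set of
`⊑`-minimal proper answer sets of `P` coincides with the set of proper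
preferred answer sets of `P`. -/
theorem minimal_proper_eq_proper_preferred
    {α : Type} [DecidableEq α] (R : Set (Rule α)) (hR : R.Countable)
    (lt : Rule α → Rule α → Prop)
    (hIrr : ∀ r ∈ R, ¬ lt r r)
    (hTrans : ∀ r₁ ∈ R, ∀ r₂ ∈ R, ∀ r₃ ∈ R, lt r₁ r₂ → lt r₂ r₃ → lt r₁ r₃)
    (hAntisymm : ∀ r₁ ∈ R, ∀ r₂ ∈ R, lt r₁ r₂ → lt r₂ r₁ → r₁ = r₂)
    (hWF : ∀ S ⊆ R, S.Nonempty → ∃ m ∈ S, ∀ r ∈ S, ¬ lt r m) :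
    {M : Set (Lit α) | ExtAnswerSet R M ∧ ProperAS R lt M ∧
        ∀ N, ExtAnswerSet R N → ProperAS R lt N → ¬ ASLt R lt N M} =
      {M : Set (Lit α) | PreferredAS R lt M ∧ ProperAS R lt M} := by
  ext M
  constructor
  · rintro ⟨hE, hP, hmin⟩
    exact ⟨⟨hE, fun N hN hlt => hmin N hN (hP.of_asSq hlt.1) hlt⟩, hP⟩
  · rintro ⟨⟨hE, hmin⟩, hP⟩
    exact ⟨hE, hP, fun N hN _ => hmin N hN⟩

end ASP
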